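/- Let x, y be unit vectors in ℝ^d with ‖x‖_∞ ≤ ρ, ‖y‖_∞ ≤ ρ and θ = ∠(x,y), let 0 < δ < 1, and assume ρ < θ²/(16 k log(k/δ)). Let D be a diagonal matrix of i.i.d. Rademacher signs, and let X_i = s_{→i}(Dx) and Y_i = s_{→i}(Dy) for i = 0, …, k−1. Then with probability at least 1 − δ over the choice of D, the sequences (X_i) and (Y_i) are (γ, k)-orthogonal with γ = 4√ρ. -/

import Mathlib

open MeasureTheory ProbabilityTheory Real
open scoped ENNReal

noncomputable section

/-- Entrywise sign: `sgn t = 1` if `t ≥ 0`, `-1` otherwise. -/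
def sgn (t : ℝ) : ℝ := if 0 ≤ t then 1 else -1

/-- Euclidean (ℓ²) norm. -/
def l2norm {ι : Type*} [Fintype ι] (x : ι → ℝ) : ℝ := Real.sqrt (∑ i, x i ^ 2)

/-- Entrywise ℓ¹ norm. -/
def l1norm {ι : Type*} [Fintype ι] (x : ι → ℝ) : ℝ := ∑ i, |x i|

/-- Supremum (ℓ∞) norm. -/
def linf {ι : Type*} [Fintype ι] (x : ι → ℝ) : ℝ := ⨆ i, |x i|

/-- Euclidean inner product. -/
def dotp {ι : Type*} [Fintype ι] (x y : ι → ℝ) : ℝ := ∑ i, x i * y i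

/-- Angle between two vectors. -/
def angle' {ι : Type*} [Fintype ι] (x y : ι → ℝ) : ℝ :=
  Real.arccos (dotp x y / (l2norm x * l2norm y))

/-- The standard Gaussian measure on `ℝ^d` (i.i.d. `N(0,1)` coordinates). -/
def gaussPi (d : ℕ) : Measure (Fin d → ℝ) := Measure.pi fun _ => gaussianReal 0 1

/-- The Rademacher measure on `ℝ`: `±1` with probability `1/2` each. -/
def radMeasure : Measure ℝ := (2 : ℝ≥0∞)⁻¹ • (Measure.dirac 1 + Measure.dirac (-1))

instance : IsProbabilityMeasure radMeasure := by
  constructor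
  simp only [radMeasure, Measure.smul_apply, Measure.coe_add, Pi.add_apply,
    Measure.dirac_apply' _ MeasurableSet.univ, Set.indicator_univ, Pi.one_apply, smul_eq_mul]
  rw [one_add_one_eq_two, ENNReal.inv_mul_cancel] <;> simp

instance (d : ℕ) : IsProbabilityMeasure (gaussPi d) := by
  unfold gaussPi; infer_instance

/-- i.i.d. Rademacher signs on `ℝ^d`. -/
def radPi (d : ℕ) : Measure (Fin d → ℝ) := Measure.pi fun _ => radMeasure

instance (d : ℕ) : IsProbabilityMeasure (radPi d) := by
  unfold radPi; infer_instance

/-- Circular shift by `t` positions: the `j`-th entry of `shift t x` is `x ((j - t) mod d)`. -/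
def shift {d : ℕ} (t : ℕ) (x : Fin d → ℝ) : Fin d → ℝ :=
  fun j => x ⟨((j : ℕ) + (d - t % d)) % d, Nat.mod_lt _ j.pos⟩

/-- The `k`-bit circulant binary embedding: `sign` of the first `k` entries of
`circ(r) · D · x`, where `D = diag D`. -/
def cbe {d k : ℕ} (hk : k ≤ d) (r D x : Fin d → ℝ) : Fin k → ℝ :=
  fun i => sgn (∑ j, r (Fin.castLE hk i - j) * (D j * x j))


/-- `(γ, k)`-orthogonality of two sequences of `k` vectors: there are decompositions
`X i = u i + e i`, `Y i = v i + f i` with `u i, v i ⟂ span{u j, v j : j ≠ i}` and all error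
terms of norm `< γ`. -/
def GKOrth {d k : ℕ} (γ : ℝ) (X Y : Fin k → Fin d → ℝ) : Prop :=
  ∃ u v e f : Fin k → Fin d → ℝ,
    (∀ i, X i = u i + e i) ∧ (∀ i, Y i = v i + f i) ∧
    (∀ i j, j ≠ i → dotp (u i) (u j) = 0 ∧ dotp (u i) (v j) = 0 ∧
                    dotp (v i) (u j) = 0 ∧ dotp (v i) (v j) = 0) ∧
    (∀ i, l2norm (e i) < γ ∧ l2norm (f i) < γ)

/-- A partially orthonormal family of at most `finrank E` vectors can be completed to an
orthonormal family. -/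
lemma exists_orthonormal_eqOn {E : Type*} [NormedAddCommGroup E] [InnerProductSpace ℝ E]
    [FiniteDimensional ℝ E] {n : ℕ} (hn : n ≤ Module.finrank ℝ E) (v : Fin n → E)
    (s : Set (Fin n)) (hv : Orthonormal ℝ (s.domRestrict v)) :
    ∃ h : Fin n → E, Orthonormal ℝ h ∧ ∀ i ∈ s, h i = v i := by
  have hinj : Function.Injective (Fin.castLE hn) := Fin.castLE_injective hn
  have hw : Orthonormal ℝ ((Fin.castLE hn '' s).domRestrict
      (Function.extend (Fin.castLE hn) v 0)) := by
    rw [orthonormal_iff_ite] at hv ⊢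
    rintro ⟨_, i, hi, rfl⟩ ⟨_, j, hj, rfl⟩
    have := hv ⟨i, hi⟩ ⟨j, hj⟩
    simp only [Set.domRestrict_apply, hinj.extend_apply] at this ⊢
    rw [this]
    exact if_congr ⟨fun h => Subtype.ext (congrArg (fun x : s => Fin.castLE hn x) h),
      fun h => Subtype.ext (hinj (congrArg Subtype.val h))⟩ rfl rfl
  obtain ⟨b, hb⟩ := hw.exists_orthonormalBasis_extension_of_card_eq
    (Fintype.card_fin _).symm
  refine ⟨b ∘ Fin.castLE hn, b.orthonormal.comp _ hinj, fun i hi => ?_⟩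
  rw [Function.comp_apply, hb _ ⟨i, hi, rfl⟩, hinj.extend_apply]

/-- Quantitative polar decomposition: a linear map `A` is as close to some linear isometry as
`A† A` is to the identity. -/
lemma exists_linearIsometry_norm_sub_le {F E : Type*} [NormedAddCommGroup F]
    [InnerProductSpace ℝ F] [FiniteDimensional ℝ F] [NormedAddCommGroup E]
    [InnerProductSpace ℝ E] [FiniteDimensional ℝ E]
    (h : Module.finrank ℝ F ≤ Module.finrank ℝ E) (A : F →ₗ[ℝ] E) :
    ∃ U : F →ₗᵢ[ℝ] E, ∀ w, ‖A w - U w‖ ≤ ‖A.adjoint (A w) - w‖ := by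
  have hT : (A.adjoint ∘ₗ A).IsSymmetric := fun x y => by
    simp [LinearMap.adjoint_inner_left, LinearMap.adjoint_inner_right]
  set b := hT.eigenvectorBasis rfl with hb
  set g := hT.eigenvalues rfl with hg
  have hTb : ∀ i, A.adjoint (A (b i)) = g i • b i := fun i => by
    exact hT.apply_eigenvectorBasis rfl i
  have hAb : ∀ i j, inner ℝ (A (b i)) (A (b j)) = if i = j then g i else 0 := fun i j => by
    rw [← LinearMap.adjoint_inner_left, hTb, inner_smul_left,
      orthonormal_iff_ite.1 b.orthonormal]
    simp
  have hg0 : ∀ i, 0 ≤ g i := fun i => by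
    have := hAb i i
    rw [if_pos rfl, real_inner_self_eq_norm_sq] at this
    rw [← this]; positivity
  obtain ⟨f, hf, hfe⟩ := exists_orthonormal_eqOn h (fun i => (√(g i))⁻¹ • A (b i))
    {i | g i ≠ 0} (by
      rw [orthonormal_iff_ite]
      rintro ⟨i, hi⟩ ⟨j, hj⟩
      simp only [Set.domRestrict_apply, inner_smul_left, inner_smul_right, hAb, Subtype.mk.injEq]
      by_cases hij : i = j
      · subst hij
        have h1 : √(g i) ≠ 0 := (Real.sqrt_pos.2 (lt_of_le_of_ne (hg0 i) (Ne.symm hi))).ne'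
        have h2 := Real.mul_self_sqrt (hg0 i)
        simp only [if_true, map_inv₀, conj_trivial]
        field_simp
        rw [sq, h2]
      · simp [hij])
  have hAf : ∀ i, A (b i) = √(g i) • f i := fun i => by
    by_cases hi : g i = 0
    · have h0 := hAb i i
      rw [if_pos rfl, hi, inner_self_eq_zero] at h0
      simp [h0, hi]
    · rw [hfe i hi, smul_smul, mul_inv_cancel₀, one_smul]
      exact (Real.sqrt_pos.2 (lt_of_le_of_ne (hg0 i) (Ne.symm hi))).ne'
  have hbo : Orthonormal ℝ b.toBasis := by simp
  have hcomp : (b.toBasis.constr ℝ f : F →ₗ[ℝ] E) ∘ b.toBasis = f := by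
    ext1 i; simp only [Function.comp_apply, Module.Basis.constr_basis]
  refine ⟨(b.toBasis.constr ℝ f).isometryOfOrthonormal hbo (by rw [hcomp]; exact hf), fun w => ?_⟩
  have hUb : ∀ i, (b.toBasis.constr ℝ f) (b i) = f i := fun i => by
    rw [← b.coe_toBasis, Module.Basis.constr_basis]
  rw [LinearMap.coe_isometryOfOrthonormal]
  have hw := b.sum_repr' w
  have h1 : A w - b.toBasis.constr ℝ f w = ∑ i, (inner ℝ (b i) w * (√(g i) - 1)) • f i := by
    conv_lhs => rw [← hw]
    simp only [map_sum, map_smul, hAf, hUb, ← Finset.sum_sub_distrib, smul_smul, ← sub_smul]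
    refine Finset.sum_congr rfl fun i _ => ?_
    congr 1; ring
  have h2 : A.adjoint (A w) - w = ∑ i, (inner ℝ (b i) w * (g i - 1)) • b i := by
    conv_lhs => rw [← hw]
    simp only [map_sum, map_smul, hTb, ← Finset.sum_sub_distrib, smul_smul, ← sub_smul]
    refine Finset.sum_congr rfl fun i _ => ?_
    congr 1; ring
  rw [h1, h2, ← sq_le_sq₀ (norm_nonneg _) (norm_nonneg _), ← real_inner_self_eq_norm_sq,
    ← real_inner_self_eq_norm_sq, hf.inner_sum, b.orthonormal.inner_sum]
  refine Finset.sum_le_sum fun i _ => ?_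
  simp only [conj_trivial, ← sq, mul_pow]
  refine mul_le_mul_of_nonneg_left ?_ (sq_nonneg _)
  have h3 := Real.sq_sqrt (hg0 i)
  have h4 := Real.sqrt_nonneg (g i)
  set r := √(g i)
  rw [← h3]
  nlinarith [mul_nonneg (sq_nonneg (r - 1)) (by positivity : 0 ≤ r * (r + 2))]

lemma l2norm_eq_norm {d : ℕ} (x : EuclideanSpace ℝ (Fin d)) : l2norm x.ofLp = ‖x‖ := by
  simp [l2norm, EuclideanSpace.norm_eq]

lemma dotp_eq_inner {d : ℕ} (x y : EuclideanSpace ℝ (Fin d)) :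
    dotp x.ofLp y.ofLp = inner ℝ x y := by
  simp [dotp, PiLp.inner_apply, mul_comm]

/-- If `X i` is a unit vector, `Q i` is a unit vector or zero orthogonal to `X i`, and
`Y i = c • X i + s • Q i`, then smallness of the inner products between different indices
gives `(γ, k)`-orthogonality. -/
lemma gkOrth_of_abs_dotp_le {d k : ℕ} (hkd : 2 * k ≤ d) (X Q Y : Fin k → Fin d → ℝ) (c s : ℝ)
    (hY : ∀ i, Y i = c • X i + s • Q i) (hXX : ∀ i, dotp (X i) (X i) = 1)
    (hXQ : ∀ i, dotp (X i) (Q i) = 0) (hQQ : ∀ i, s * dotp (Q i) (Q i) = s)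
    (τ γ : ℝ) (hγ : 0 ≤ γ) (hτγ : 2 * (k - 1) * τ ^ 2 < γ ^ 2)
    (h1 : ∀ i j, i ≠ j → |dotp (X i) (X j)| ≤ τ) (h2 : ∀ i j, i ≠ j → |dotp (X i) (Q j)| ≤ τ)
    (h3 : ∀ i j, i ≠ j → |dotp (Y i) (X j)| ≤ τ) (h4 : ∀ i j, i ≠ j → |dotp (Y i) (Q j)| ≤ τ) :
    GKOrth γ X Y := by
  set V : Fin k ⊕ Fin k → EuclideanSpace ℝ (Fin d) :=
    Sum.elim (fun i => WithLp.toLp 2 (X i)) (fun i => WithLp.toLp 2 (Q i)) with hV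
  set b := EuclideanSpace.basisFun (Fin k ⊕ Fin k) ℝ with hb
  set A := b.toBasis.constr ℝ V with hA
  have hAb : ∀ m, A (b m) = V m := fun m => by
    rw [hA, ← b.coe_toBasis, Module.Basis.constr_basis]
  obtain ⟨U, hU⟩ := exists_linearIsometry_norm_sub_le (by simp; omega) A
  have hbb : ∀ m m', inner ℝ (b m) (b m') = if m = m' then (1 : ℝ) else 0 :=
    orthonormal_iff_ite.1 b.orthonormal
  have key : ∀ (i : Fin k) (α β : ℝ) (W : Fin d → ℝ), W = α • X i + β • Q i →
      β * dotp (Q i) (Q i) = β → (∀ j, i ≠ j → |dotp W (X j)| ≤ τ) →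
      (∀ j, i ≠ j → |dotp W (Q j)| ≤ τ) →
      l2norm (W - (U (α • b (.inl i) + β • b (.inr i))).ofLp) < γ := by
    intro i α β W hW hβ hWX hWQ
    set w := α • b (.inl i) + β • b (.inr i) with hw
    have hAw : A w = WithLp.toLp 2 W := by
      rw [hw, map_add, map_smul, map_smul, hAb, hAb, hW]; rfl
    have e1 : W - (U w).ofLp = (A w - U w).ofLp := by rw [hAw]; rfl
    rw [e1, l2norm_eq_norm]
    refine (hU w).trans_lt ?_
    rw [← sq_lt_sq₀ (norm_nonneg _) hγ, ← b.sum_sq_norm_inner_right]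
    refine lt_of_le_of_lt ?_ hτγ
    have e2 : ∀ m, inner ℝ (b m) (A.adjoint (A w) - w)
        = inner ℝ (V m) (WithLp.toLp 2 W) - inner ℝ (b m) w := fun m => by
      rw [inner_sub_right, LinearMap.adjoint_inner_right, hAb, hAw]
    have eX : ∀ j, inner ℝ (V (.inl j)) (WithLp.toLp 2 W) = dotp W (X j) := fun j => by
      rw [real_inner_comm]; exact (dotp_eq_inner _ _).symm
    have eQ : ∀ j, inner ℝ (V (.inr j)) (WithLp.toLp 2 W) = dotp W (Q j) := fun j => by
      rw [real_inner_comm]; exact (dotp_eq_inner _ _).symm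
    have dW : ∀ Z, dotp W Z = α * dotp (X i) Z + β * dotp (Q i) Z := fun Z => by
      simp only [hW, dotp, Finset.mul_sum, ← Finset.sum_add_distrib]
      refine Finset.sum_congr rfl fun l _ => ?_
      simp; ring
    have hQX : dotp (Q i) (X i) = 0 := by
      rw [← hXQ i]; simp [dotp, mul_comm]
    simp only [e2, Fintype.sum_sum_type, eX, eQ, Real.norm_eq_abs, sq_abs]
    have bX : ∀ j, (dotp W (X j) - inner ℝ (b (.inl j)) w) ^ 2 ≤ if i = j then 0 else τ ^ 2 := by
      intro j
      rw [hw, inner_add_right, inner_smul_right, inner_smul_right, hbb, hbb]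
      by_cases hij : i = j
      · subst hij; simp [dW, hXX, hQX]
      · have := hWX j hij
        simp only [Sum.inl.injEq, Ne.symm hij, hij, if_false, reduceCtorEq, mul_zero, add_zero,
          sub_zero]
        exact sq_le_sq' (abs_le.1 this).1 (abs_le.1 this).2
    have bQ : ∀ j, (dotp W (Q j) - inner ℝ (b (.inr j)) w) ^ 2 ≤ if i = j then 0 else τ ^ 2 := by
      intro j
      rw [hw, inner_add_right, inner_smul_right, inner_smul_right, hbb, hbb]
      by_cases hij : i = j
      · subst hij; simp [dW, hXQ, hβ]
      · have := hWQ j hij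
        simp only [Sum.inr.injEq, Ne.symm hij, hij, if_false, reduceCtorEq, mul_zero, add_zero,
          sub_zero]
        exact sq_le_sq' (abs_le.1 this).1 (abs_le.1 this).2
    have hs : ∑ j, (if i = j then 0 else τ ^ 2) = (k - 1) * τ ^ 2 := by
      have : ∀ j, (if i = j then 0 else τ ^ 2) = τ ^ 2 - if i = j then τ ^ 2 else 0 :=
        fun j => by split_ifs <;> simp
      simp only [this, Finset.sum_sub_distrib, Finset.sum_ite_eq, Finset.mem_univ, if_true]
      simp; ring
    refine (add_le_add (Finset.sum_le_sum fun j _ => bX j)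
      (Finset.sum_le_sum fun j _ => bQ j)).trans (le_of_eq ?_)
    rw [hs]; ring
  refine ⟨fun i => (U (b (.inl i))).ofLp, fun i => (U (c • b (.inl i) + s • b (.inr i))).ofLp,
    fun i => X i - (U (b (.inl i))).ofLp,
    fun i => Y i - (U (c • b (.inl i) + s • b (.inr i))).ofLp, fun i => by simp,
    fun i => by simp, fun i j hij => ?_, fun i => ⟨?_, ?_⟩⟩
  · simp only [dotp_eq_inner, U.inner_map_map, inner_add_left, inner_add_right, inner_smul_left,
      inner_smul_right, hbb]
    simp [Ne.symm hij]
  · simpa using key i 1 0 (X i) (by simp) (by simp) (h1 i) (h2 i)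
  · exact key i c s (Y i) (hY i) (hQQ i) (h3 i) (h4 i)

/-- The real vector of signs attached to an element of `{±1}^ι`. -/
def signVec {ι : Type*} (ω : ι → ℤˣ) : ι → ℝ := fun i => ((ω i : ℤ) : ℝ)

lemma signVec_eq_or {ι : Type*} (ω : ι → ℤˣ) (i : ι) : signVec ω i = 1 ∨ signVec ω i = -1 := by
  rcases Int.units_eq_one_or (ω i) with h | h <;> simp [signVec, h]

/-- Moment generating function of a Rademacher chaos supported on edges `l → f l` that all
increase the index. -/
lemma sum_exp_chaos_le_of_lt {ι : Type*} [Fintype ι] [LinearOrder ι] (f : ι → ι) (c : ι → ℝ)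
    (S : Finset ι) (hf : ∀ l ∈ S, l < f l) :
    ∑ ω : ι → ℤˣ, Real.exp (∑ l ∈ S, c l * (signVec ω l * signVec ω (f l)))
      ≤ 2 ^ Fintype.card ι * Real.exp (∑ l ∈ S, c l ^ 2 / 2) := by
  induction S using Finset.induction_on_min with
  | empty => simp
  | insert a S ha ih =>
    have haS : a ∉ S := fun h => lt_irrefl _ (ha a h)
    have ih' := ih fun l hl => hf l (Finset.mem_insert_of_mem hl)
    have haf : a < f a := hf a (Finset.mem_insert_self _ _)
    set R : (ι → ℤˣ) → ℝ := fun ω => ∑ l ∈ S, c l * (signVec ω l * signVec ω (f l)) with hR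
    set φ : (ι → ℤˣ) ≃ (ι → ℤˣ) := Equiv.mulLeft (Pi.mulSingle a (-1)) with hφ
    have hφa : ∀ ω, signVec (φ ω) a = - signVec ω a := fun ω => by simp [hφ, signVec]
    have hφne : ∀ ω l, l ≠ a → signVec (φ ω) l = signVec ω l := fun ω l hl => by
      simp [hφ, signVec, hl]
    have hφR : ∀ ω, R (φ ω) = R ω := fun ω => by
      refine Finset.sum_congr rfl fun l hl => ?_
      rw [hφne ω l (ha l hl).ne', hφne ω (f l)
        ((ha l hl).trans (hf l (Finset.mem_insert_of_mem hl))).ne']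
    simp only [Finset.sum_insert haS]
    have e1 : ∑ ω, Real.exp (c a * (signVec ω a * signVec ω (f a)) + R ω)
        = ∑ ω, Real.exp (-(c a * (signVec ω a * signVec ω (f a))) + R ω) := by
      rw [← Equiv.sum_comp φ]
      refine Finset.sum_congr rfl fun ω _ => ?_
      rw [hφR, hφa, hφne ω _ haf.ne']
      ring_nf
    have e2 : ∑ ω, Real.exp (c a * (signVec ω a * signVec ω (f a)) + R ω)
        = ∑ ω, Real.cosh (c a) * Real.exp (R ω) := by
      have : ∀ ω, Real.cosh (c a) * Real.exp (R ω)
          = (Real.exp (c a * (signVec ω a * signVec ω (f a)) + R ω)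
            + Real.exp (-(c a * (signVec ω a * signVec ω (f a))) + R ω)) / 2 := fun ω => by
        rw [Real.cosh_eq, Real.exp_add, Real.exp_add]
        rcases signVec_eq_or ω a with h | h <;> rcases signVec_eq_or ω (f a) with h' | h' <;>
          simp only [h, h'] <;> ring_nf
      simp only [this]
      rw [← Finset.sum_div, Finset.sum_add_distrib, ← e1]
      ring
    rw [e2, ← Finset.mul_sum, Real.exp_add]
    calc Real.cosh (c a) * ∑ ω, Real.exp (R ω)
        ≤ Real.exp (c a ^ 2 / 2)
          * (2 ^ Fintype.card ι * Real.exp (∑ l ∈ S, c l ^ 2 / 2)) :=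
          mul_le_mul (Real.cosh_le_exp_half_sq _) ih'
            (Finset.sum_nonneg fun _ _ => (Real.exp_pos _).le) (Real.exp_pos _).le
      _ = _ := by ring

/-- Moment generating function of a Rademacher chaos supported on edges `l → f l` without
loops. -/
lemma sum_exp_chaos_le {ι : Type*} [Fintype ι] [LinearOrder ι] (f : ι → ι) (c : ι → ℝ)
    (hf : ∀ l, f l ≠ l) :
    ∑ ω : ι → ℤˣ, Real.exp (∑ l, c l * (signVec ω l * signVec ω (f l)))
      ≤ 2 ^ Fintype.card ι * Real.exp (∑ l, c l ^ 2) := by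
  set S : Finset ι := {l | l < f l} with hS
  set S' : Finset ι := {l | ¬ l < f l} with hS'
  have hlt : ∀ l ∈ S', f l < l := fun l hl =>
    lt_of_le_of_ne (not_lt.1 (Finset.mem_filter.1 hl).2) (hf l)
  have h1 := sum_exp_chaos_le_of_lt f (fun l => 2 * c l) S fun l hl => by simpa [hS] using hl
  have h2 : ∑ ω : ι → ℤˣ, Real.exp (∑ l ∈ S', 2 * c l * (signVec ω l * signVec ω (f l)))
      ≤ 2 ^ Fintype.card ι * Real.exp (∑ l ∈ S', (2 * c l) ^ 2 / 2) :=
    sum_exp_chaos_le_of_lt (ι := ιᵒᵈ) f (fun l => 2 * c l) S' hlt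
  have hsplit : ∀ g : ι → ℝ, ∑ l, g l = ∑ l ∈ S, g l + ∑ l ∈ S', g l := fun g =>
    (Finset.sum_filter_add_sum_filter_not _ _ _).symm
  have hcs := Finset.sum_mul_sq_le_sq_mul_sq (Finset.univ : Finset (ι → ℤˣ))
    (fun ω => Real.exp (∑ l ∈ S, c l * (signVec ω l * signVec ω (f l))))
    (fun ω => Real.exp (∑ l ∈ S', c l * (signVec ω l * signVec ω (f l))))
  simp only [← Real.exp_add, ← hsplit, sq (Real.exp _)] at hcs
  simp only [← two_mul] at hcs
  simp only [mul_assoc (2 : ℝ), ← Finset.mul_sum] at h1 h2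
  refine (sq_le_sq₀ (Finset.sum_nonneg fun _ _ => (Real.exp_pos _).le) (by positivity)).1
    (hcs.trans ((mul_le_mul h1 h2
    (Finset.sum_nonneg fun _ _ => (Real.exp_pos _).le) (by positivity)).trans (le_of_eq ?_)))
  have e : ∀ l, (2 * c l) ^ 2 / 2 = 2 * c l ^ 2 := fun l => by ring
  simp only [e]
  rw [mul_mul_mul_comm, ← Real.exp_add, ← hsplit, mul_pow, ← Real.exp_nat_mul, ← Finset.mul_sum]
  push_cast
  ring

lemma card_le_chaos_le {ι : Type*} [Fintype ι] [LinearOrder ι] (f : ι → ι) (c : ι → ℝ)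
    (hf : ∀ l, f l ≠ l) {σ τ : ℝ} (hσ : 0 < σ) (hτ : 0 ≤ τ) (hc : ∑ l, c l ^ 2 ≤ σ ^ 2) :
    (Finset.card {ω : ι → ℤˣ | τ ≤ ∑ l, c l * (signVec ω l * signVec ω (f l))} : ℝ)
      ≤ 2 ^ Fintype.card ι * Real.exp (-(τ ^ 2 / (4 * σ ^ 2))) := by
  set r := τ / (2 * σ ^ 2) with hr
  have hr0 : 0 ≤ r := by positivity
  have h1 := sum_exp_chaos_le f (fun l => r * c l) hf
  have h2 : (Finset.card {ω : ι → ℤˣ | τ ≤ ∑ l, c l * (signVec ω l * signVec ω (f l))} : ℝ)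
      * Real.exp (r * τ)
      ≤ ∑ ω : ι → ℤˣ, Real.exp (∑ l, r * c l * (signVec ω l * signVec ω (f l))) := by
    rw [← nsmul_eq_mul, ← Finset.sum_const]
    refine (Finset.sum_le_sum fun ω hω => ?_).trans
      (Finset.sum_le_sum_of_subset_of_nonneg (Finset.subset_univ _)
        fun _ _ _ => (Real.exp_pos _).le)
    simp only [Finset.mem_filter, Finset.mem_univ, true_and] at hω
    simp only [mul_assoc r, ← Finset.mul_sum]
    exact Real.exp_le_exp.2 (mul_le_mul_of_nonneg_left hω hr0)
  have h3 : ∑ l, (r * c l) ^ 2 ≤ r ^ 2 * σ ^ 2 := by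
    simp only [mul_pow, ← Finset.mul_sum]
    exact mul_le_mul_of_nonneg_left hc (sq_nonneg _)
  have h4 : -(τ ^ 2 / (4 * σ ^ 2)) = r ^ 2 * σ ^ 2 - r * τ := by
    rw [hr]; field_simp; ring
  rw [h4, Real.exp_sub, ← mul_div_assoc, le_div_iff₀ (Real.exp_pos _)]
  exact (h2.trans h1).trans (mul_le_mul_of_nonneg_left (Real.exp_le_exp.2 h3) (by positivity))

/-- Tail bound for a Rademacher chaos supported on edges `l → f l` without loops. -/
lemma card_le_abs_chaos_le {ι : Type*} [Fintype ι] [LinearOrder ι] (f : ι → ι) (c : ι → ℝ)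
    (hf : ∀ l, f l ≠ l) {σ τ : ℝ} (hσ : 0 < σ) (hτ : 0 ≤ τ) (hc : ∑ l, c l ^ 2 ≤ σ ^ 2) :
    (Finset.card {ω : ι → ℤˣ | τ ≤ |∑ l, c l * (signVec ω l * signVec ω (f l))|} : ℝ)
      ≤ 2 * (2 ^ Fintype.card ι * Real.exp (-(τ ^ 2 / (4 * σ ^ 2)))) := by
  classical
  have h1 := card_le_chaos_le f c hf hσ hτ hc
  have h2 := card_le_chaos_le f (fun l => - c l) hf hσ hτ (by simpa using hc)
  have h3 : (Finset.univ.filter fun ω : ι → ℤˣ =>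
      τ ≤ |∑ l, c l * (signVec ω l * signVec ω (f l))|)
      ⊆ (Finset.univ.filter fun ω => τ ≤ ∑ l, c l * (signVec ω l * signVec ω (f l)))
        ∪ (Finset.univ.filter fun ω => τ ≤ ∑ l, - c l * (signVec ω l * signVec ω (f l))) := by
    intro ω hω
    simpa [le_abs] using hω
  have h4 := (Finset.card_le_card h3).trans (Finset.card_union_le _ _)
  have h5 : (Finset.card {ω : ι → ℤˣ | τ ≤ |∑ l, c l * (signVec ω l * signVec ω (f l))|} : ℝ)
      ≤ ((Finset.card {ω : ι → ℤˣ | τ ≤ ∑ l, c l * (signVec ω l * signVec ω (f l))} +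
        Finset.card {ω : ι → ℤˣ | τ ≤ ∑ l, - c l * (signVec ω l * signVec ω (f l))} : ℕ) : ℝ) := by
    exact_mod_cast h4
  push_cast at h5
  linarith

/-- The Rademacher measure is the uniform distribution on sign vectors. -/
lemma radPi_eq_sum (d : ℕ) : radPi d = ∑ ω : Fin d → ℤˣ,
    ((2 : ℝ≥0∞)⁻¹ ^ d) • Measure.dirac (signVec ω) := by
  refine (Measure.pi_eq fun s hs => ?_)
  have h1 : ∀ i, radMeasure (s i)
      = ∑ u : ℤˣ, (2 : ℝ≥0∞)⁻¹ * (s i).indicator 1 (((u : ℤ) : ℝ)) := fun i => by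
    have : (Finset.univ : Finset ℤˣ) = {1, -1} := rfl
    rw [this, Finset.sum_pair (by decide)]
    simp [radMeasure, Measure.dirac_apply' _ (hs i)]
  simp only [h1]
  rw [Finset.prod_univ_sum, Fintype.piFinset_univ]
  simp only [Measure.coe_finsetSum, Finset.sum_apply, Measure.coe_smul, Pi.smul_apply,
    smul_eq_mul]
  refine Finset.sum_congr rfl fun ω _ => ?_
  rw [Measure.dirac_apply' _ (MeasurableSet.univ_pi hs), Finset.prod_mul_distrib,
    Finset.prod_const, Finset.card_univ, Fintype.card_fin]
  congr 1
  classical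
  by_cases h : ∀ i, signVec ω i ∈ s i
  · rw [Set.indicator_of_mem (by simpa using h)]
    symm
    refine Finset.prod_eq_one fun i _ => ?_
    exact Set.indicator_of_mem (h i) _
  · rw [Set.indicator_of_notMem (by simpa using h)]
    push Not at h
    obtain ⟨i, hi⟩ := h
    exact (Finset.prod_eq_zero (Finset.mem_univ i) (Set.indicator_of_notMem hi _)).symm

lemma le_radPi_of_card_le {d : ℕ} {δ : ℝ} (S : Set (Fin d → ℝ)) (B : Finset (Fin d → ℤˣ))
    (hB : (B.card : ℝ) ≤ 2 ^ d * δ) (hS : ∀ ω ∉ B, signVec ω ∈ S) :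
    1 - δ ≤ (radPi d S).toReal := by
  classical
  have h1 : ((Bᶜ.card : ℝ≥0∞)) * (2 : ℝ≥0∞)⁻¹ ^ d ≤ radPi d S := by
    rw [radPi_eq_sum, ← nsmul_eq_mul, ← Finset.sum_const]
    simp only [Measure.coe_finsetSum, Finset.sum_apply, Measure.coe_smul, Pi.smul_apply,
      smul_eq_mul]
    refine (Finset.sum_le_sum fun ω hω => ?_).trans
      (Finset.sum_le_sum_of_subset (Finset.subset_univ _))
    rw [Measure.dirac_apply_of_mem (hS ω (by simpa using hω)), mul_one]
  have h2 := ENNReal.toReal_mono (measure_ne_top _ _) h1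
  refine le_trans ?_ h2
  have h3 : (Bᶜ.card : ℝ) = 2 ^ d - B.card := by
    rw [Finset.card_compl, Nat.cast_sub (Finset.card_le_univ _)]
    simp [Fintype.card_units_int]
  simp only [ENNReal.toReal_mul, ENNReal.toReal_natCast, ENNReal.toReal_pow, ENNReal.toReal_inv,
    ENNReal.toReal_ofNat, h3]
  rw [inv_pow, ← div_eq_mul_inv, le_div_iff₀ (by positivity)]
  linarith

lemma shift_apply {d : ℕ} [NeZero d] (t : ℕ) (x : Fin d → ℝ) (j : Fin d) :
    shift t x j = x (j - Fin.ofNat d t) := by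
  simp only [shift]
  congr 1
  apply Fin.ext
  simp [Fin.sub_def, add_comm]

lemma dotp_shift_shift {d : ℕ} [NeZero d] (D w z : Fin d → ℝ) (i j : ℕ) :
    dotp (shift i fun l => D l * w l) (shift j fun l => D l * z l)
      = ∑ l, w l * z (l + (Fin.ofNat d i - Fin.ofNat d j))
        * (D l * D (l + (Fin.ofNat d i - Fin.ofNat d j))) := by
  rw [dotp, ← Equiv.sum_comp (Equiv.addRight (Fin.ofNat d i))]
  refine Finset.sum_congr rfl fun l _ => ?_
  simp only [shift_apply, Equiv.coe_addRight, add_sub_cancel_right, add_sub_assoc]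
  ring

lemma dotp_shift_self {d : ℕ} [NeZero d] (ω : Fin d → ℤˣ) (w z : Fin d → ℝ) (i : ℕ) :
    dotp (shift i fun l => signVec ω l * w l) (shift i fun l => signVec ω l * z l)
      = dotp w z := by
  rw [dotp_shift_shift, dotp]
  refine Finset.sum_congr rfl fun l _ => ?_
  rw [sub_self, add_zero]
  rcases signVec_eq_or ω l with h | h <;> simp [h]

/-- The nonzero differences between elements of `{0, …, k - 1}`, modulo `d`. -/
def shiftDiffs (d k : ℕ) [NeZero d] : Finset (Fin d) :=
  (Finset.Ico 1 k).image (Fin.ofNat d) ∪ (Finset.Ico 1 k).image fun t => -Fin.ofNat d t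

lemma card_shiftDiffs_le (d k : ℕ) [NeZero d] : (shiftDiffs d k).card ≤ 2 * (k - 1) := by
  refine (Finset.card_union_le _ _).trans ?_
  have h1 := Finset.card_image_le (s := Finset.Ico 1 k) (f := Fin.ofNat d)
  have h2 := Finset.card_image_le (s := Finset.Ico 1 k) (f := fun t => -Fin.ofNat d t)
  rw [Nat.card_Ico] at h1 h2
  omega

lemma zero_notMem_shiftDiffs {d k : ℕ} [NeZero d] (hkd : k ≤ d) : 0 ∉ shiftDiffs d k := by
  have h : ∀ t ∈ Finset.Ico 1 k, Fin.ofNat d t ≠ 0 := fun t ht h => by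
    rw [Finset.mem_Ico] at ht
    have := congrArg Fin.val h
    simp only [Fin.ofNat, Fin.val_zero, Nat.mod_eq_of_lt (ht.2.trans_le hkd)] at this
    omega
  simp only [shiftDiffs, Finset.mem_union, Finset.mem_image, neg_eq_zero]
  rintro (⟨t, ht, h0⟩ | ⟨t, ht, h0⟩) <;> exact h t ht h0

lemma ofNat_sub_ofNat_mem_shiftDiffs {d k : ℕ} [NeZero d] (hkd : k ≤ d) {i j : ℕ} (hi : i < k)
    (hj : j < k) (hij : i ≠ j) : Fin.ofNat d i - Fin.ofNat d j ∈ shiftDiffs d k := by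
  have key : ∀ a b : ℕ, b < a → a < k → Fin.ofNat d a - Fin.ofNat d b = Fin.ofNat d (a - b) := by
    intro a b hb ha
    apply Fin.ext
    simp only [Fin.sub_def, Fin.ofNat, Nat.mod_eq_of_lt (ha.trans_le hkd),
      Nat.mod_eq_of_lt ((hb.trans ha).trans_le hkd)]
    rw [show d - b + a = a - b + d by omega, Nat.add_mod_right]
  simp only [shiftDiffs, Finset.mem_union, Finset.mem_image, Finset.mem_Ico]
  rcases lt_or_gt_of_ne hij with h | h
  · exact Or.inr ⟨j - i, by omega, by rw [← key j i h hj, neg_sub]⟩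
  · exact Or.inl ⟨i - j, by omega, (key i j h hi).symm⟩

/-- The sign vectors for which some shifted inner product of `Dw` and `Dz`, with `w ∈ W` and
`z ∈ Z`, is at least `τ` in absolute value are rare. -/
lemma exists_card_le_forall_abs_dotp_lt {d k : ℕ} [NeZero d] (hkd : k ≤ d) (W Z : Fin 2 → Fin d → ℝ)
    {ρ τ : ℝ} (hρ : 0 < ρ) (hτ : 0 ≤ τ) (hW : ∀ a l, |W a l| ≤ ρ)
    (hZ : ∀ b, dotp (Z b) (Z b) ≤ 1) :
    ∃ B : Finset (Fin d → ℤˣ),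
      (B.card : ℝ) ≤ 16 * ((k - 1 : ℕ) : ℝ) * (2 ^ d * Real.exp (-(τ ^ 2 / (4 * ρ ^ 2)))) ∧
      ∀ ω ∉ B, ∀ a b, ∀ i < k, ∀ j < k, i ≠ j →
        |dotp (shift i fun l => signVec ω l * W a l) (shift j fun l => signVec ω l * Z b l)|
          ≤ τ := by
  set bad : Fin d × Fin 2 × Fin 2 → Finset (Fin d → ℤˣ) := fun p =>
    {ω | τ ≤ |∑ l, W p.2.1 l * Z p.2.2 (l + p.1) * (signVec ω l * signVec ω (l + p.1))|} with hbad
  refine ⟨(shiftDiffs d k ×ˢ Finset.univ).biUnion bad, ?_, ?_⟩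
  · set M := 2 * (2 ^ d * Real.exp (-(τ ^ 2 / (4 * ρ ^ 2)))) with hM
    have hM0 : 0 ≤ M := by positivity
    have hb : ∀ p ∈ shiftDiffs d k ×ˢ (Finset.univ : Finset (Fin 2 × Fin 2)),
        ((bad p).card : ℝ) ≤ M := by
      rintro ⟨t, a, b⟩ hp
      have ht : t ≠ 0 := fun h0 =>
        zero_notMem_shiftDiffs hkd (h0 ▸ (Finset.mem_product.1 hp).1)
      have := card_le_abs_chaos_le (fun l => l + t) (fun l => W a l * Z b (l + t))
        (fun l => by simpa using ht) hρ hτ (by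
          calc ∑ l, (W a l * Z b (l + t)) ^ 2 ≤ ∑ l, ρ ^ 2 * Z b (l + t) ^ 2 := by
                refine Finset.sum_le_sum fun l _ => ?_
                rw [mul_pow]
                exact mul_le_mul_of_nonneg_right
                  (sq_le_sq' (abs_le.1 (hW a l)).1 (abs_le.1 (hW a l)).2) (sq_nonneg _)
            _ = ρ ^ 2 * dotp (Z b) (Z b) := by
                rw [← Finset.mul_sum, dotp,
                  ← Equiv.sum_comp (Equiv.addRight t) fun l => Z b l * Z b l]
                simp [sq]
            _ ≤ ρ ^ 2 := mul_le_of_le_one_right (sq_nonneg _) (hZ b))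
      simpa [hbad, hM] using this
    calc ((((shiftDiffs d k ×ˢ Finset.univ).biUnion bad).card : ℕ) : ℝ)
        ≤ ∑ p ∈ shiftDiffs d k ×ˢ Finset.univ, ((bad p).card : ℝ) := by
          exact_mod_cast Finset.card_biUnion_le
      _ ≤ ((shiftDiffs d k).card * 4 : ℕ) * M := by
          refine (Finset.sum_le_sum hb).trans (le_of_eq ?_)
          simp [Finset.card_product]
      _ ≤ ((2 * (k - 1) * 4 : ℕ) : ℝ) * M := by
          refine mul_le_mul_of_nonneg_right ?_ hM0
          exact_mod_cast Nat.mul_le_mul_right 4 (card_shiftDiffs_le d k)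
      _ = _ := by rw [hM]; push_cast; ring
  · intro ω hω a b i hi j hj hij
    by_contra! hlt
    refine hω (Finset.mem_biUnion.2 ⟨(Fin.ofNat d i - Fin.ofNat d j, a, b),
      Finset.mem_product.2 ⟨ofNat_sub_ofNat_mem_shiftDiffs hkd hi hj hij, Finset.mem_univ _⟩, ?_⟩)
    rw [dotp_shift_shift] at hlt
    simpa [hbad] using hlt.le

lemma pred_mul_log_le {k : ℕ} (hk : 2 ≤ k) {δ : ℝ} (hδ0 : 0 < δ) (hδ1 : δ < 1) :
    ((k : ℝ) - 1) * Real.log (16 * (k - 1) / δ) ≤ 3 * k * Real.log (k / δ) := by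
  have hk2 : (2 : ℝ) ≤ k := by exact_mod_cast hk
  have hL : 0 ≤ Real.log (k / δ) :=
    Real.log_nonneg (by rw [le_div_iff₀ hδ0]; linarith)
  have key : ∀ m : ℕ, 0 < m → 16 * ((k : ℝ) - 1) ≤ k ^ m →
      Real.log (16 * (k - 1) / δ) ≤ m * Real.log (k / δ) := by
    intro m hm h
    rw [← Real.log_pow]
    refine Real.log_le_log (div_pos (by linarith) hδ0) ?_
    rw [div_pow]
    have : δ ^ m ≤ δ := pow_le_of_le_one hδ0.le hδ1.le hm.ne'
    exact div_le_div₀ (by positivity) h (by positivity) this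
  obtain rfl | rfl | h4 : k = 2 ∨ k = 3 ∨ 4 ≤ k := by omega
  · have := key 4 (by norm_num) (by norm_num)
    push_cast at *
    linarith
  · have := key 4 (by norm_num) (by norm_num)
    push_cast at *
    linarith
  · have h4' : (4 : ℝ) ≤ k := by exact_mod_cast h4
    have := key 3 (by norm_num) (by nlinarith [mul_nonneg (sub_nonneg.2 h4') (sub_nonneg.2 h4')])
    push_cast at this
    nlinarith

lemma dotp_self_eq_sq {ι : Type*} [Fintype ι] (x : ι → ℝ) : dotp x x = l2norm x ^ 2 := by
  rw [l2norm, Real.sq_sqrt (Finset.sum_nonneg fun _ _ => sq_nonneg _)]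
  simp [dotp, sq]

lemma abs_le_linf {ι : Type*} [Fintype ι] (x : ι → ℝ) (i : ι) : |x i| ≤ linf x :=
  le_ciSup (f := fun i => |x i|) (Set.finite_range _).bddAbove i

lemma gkOrth_of_le_one {d k : ℕ} (hk : k ≤ 1) {γ : ℝ} (hγ : 0 < γ) (X Y : Fin k → Fin d → ℝ) :
    GKOrth γ X Y :=
  ⟨X, Y, 0, 0, by simp, by simp, fun i j hij => absurd (Fin.ext (by omega)) hij,
    fun i => by simpa [l2norm] using hγ⟩

/-- For unit vectors `x, y` with `‖x‖∞, ‖y‖∞ ≤ ρ`, `θ = ∠(x,y)`, `0 < δ < 1` and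
`ρ < θ²/(16 k log(k/δ))`, with probability at least `1 − δ` over the Rademacher signs `D`, the
shifts `X_i = s_{→i}(Dx)`, `Y_i = s_{→i}(Dy)`, `i = 0, …, k−1`, are `(4√ρ, k)`-orthogonal. -/
theorem stmt13 {d k : ℕ} (x y : Fin d → ℝ) (hx : l2norm x = 1) (hy : l2norm y = 1)
    (ρ : ℝ) (hxρ : linf x ≤ ρ) (hyρ : linf y ≤ ρ)
    (θ : ℝ) (hθ : θ = angle' x y) (δ : ℝ) (hδ0 : 0 < δ) (hδ1 : δ < 1)
    (hρθ : ρ < θ ^ 2 / (16 * k * Real.log (k / δ))) :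
    1 - δ ≤ ((radPi d) {D : Fin d → ℝ |
        GKOrth (4 * Real.sqrt ρ)
          (fun i : Fin k => shift (i : ℕ) (fun l => D l * x l))
          (fun i : Fin k => shift (i : ℕ) (fun l => D l * y l))}).toReal := by
  have hxl : ∀ l, |x l| ≤ ρ := fun l => (abs_le_linf x l).trans hxρ
  have hyl : ∀ l, |y l| ≤ ρ := fun l => (abs_le_linf y l).trans hyρ
  have hxx : dotp x x = 1 := by rw [dotp_self_eq_sq, hx, one_pow]
  have hdρ : 1 ≤ d * ρ ^ 2 := by
    rw [← hxx]
    calc dotp x x ≤ ∑ _l : Fin d, ρ ^ 2 := Finset.sum_le_sum fun l _ => by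
          rw [← sq]; exact sq_le_sq' (abs_le.1 (hxl l)).1 (abs_le.1 (hxl l)).2
      _ = d * ρ ^ 2 := by simp
  have hd0 : d ≠ 0 := by rintro rfl; norm_num at hdρ
  have : NeZero d := ⟨hd0⟩
  have hρ : 0 < ρ := by
    refine lt_of_le_of_ne ((abs_nonneg _).trans (hxl 0)) ?_
    rintro rfl
    norm_num at hdρ
  have hγ : 0 < 4 * √ρ := by positivity
  rcases le_or_gt k 1 with hk1 | hk2
  · refine le_radPi_of_card_le _ ∅ (by simp; positivity) fun ω _ => ?_
    exact gkOrth_of_le_one hk1 hγ _ _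
  have hk2' : (2 : ℝ) ≤ k := by exact_mod_cast hk2
  have hlog := pred_mul_log_le hk2 hδ0 hδ1
  set L := Real.log (k / δ) with hL
  have hL2 : 0.69 < L := by
    have : Real.log 2 ≤ L :=
      Real.log_le_log two_pos (by rw [le_div_iff₀ hδ0]; nlinarith)
    linarith [Real.log_two_gt_d9]
  have hθ2 : θ ^ 2 < 10 := by
    have h0 : 0 ≤ θ := hθ ▸ Real.arccos_nonneg _
    have h1 : θ ≤ Real.pi := hθ ▸ Real.arccos_le_pi _
    nlinarith [Real.pi_lt_d2]
  have hρk : 16 * (ρ * k * L) < 10 := by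
    rw [lt_div_iff₀ (by positivity)] at hρθ
    linarith
  have hkd : 2 * k ≤ d := by
    have h1 : ρ * k < 0.91 := by
      by_contra! h
      nlinarith
    have h2 : (ρ * k) ^ 2 < 1 := by
      have : 0 < ρ * k := by positivity
      nlinarith
    have h3 : (k : ℝ) ^ 2 ≤ d := by
      have : (k : ℝ) ^ 2 * 1 ≤ k ^ 2 * (d * ρ ^ 2) :=
        mul_le_mul_of_nonneg_left hdρ (sq_nonneg _)
      nlinarith [mul_nonneg (Nat.cast_nonneg (α := ℝ) d) (sub_nonneg.2 h2.le)]
    have h4 : (2 * k : ℝ) ≤ d := by nlinarith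
    exact_mod_cast h4
  have hpos : (1 : ℝ) ≤ 16 * (k - 1) / δ := by
    rw [le_div_iff₀ hδ0]; nlinarith
  set M := Real.log (16 * (k - 1) / δ) with hM
  have hM0 : 0 ≤ M := Real.log_nonneg hpos
  set τ := 2 * ρ * √M with hτ
  have hτ0 : 0 ≤ τ := by positivity
  have hτ2 : τ ^ 2 = 4 * ρ ^ 2 * M := by rw [hτ, mul_pow, Real.sq_sqrt hM0]; ring
  set c := dotp x y with hc
  set r := y - c • x with hr
  set s := l2norm r with hs
  set q := s⁻¹ • r with hq
  have hrr : dotp r r = s ^ 2 := dotp_self_eq_sq r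
  have hqq : dotp q q = s⁻¹ ^ 2 * s ^ 2 := by
    rw [← hrr, hq]
    simp only [dotp, Finset.mul_sum]
    exact Finset.sum_congr rfl fun l _ => by simp; ring
  have hxq : dotp x q = 0 := by
    have : dotp x q = s⁻¹ * (dotp x y - c * dotp x x) := by
      rw [hq, hr]
      simp only [dotp, Finset.mul_sum, ← Finset.sum_sub_distrib]
      exact Finset.sum_congr rfl fun l _ => by simp; ring
    rw [this, hxx, ← hc]; ring
  have hyq : ∀ l, y l = c * x l + s * q l := fun l => by
    have h1 : r l = y l - c * x l := by simp [hr]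
    by_cases h0 : s = 0
    · have h2 : r l = 0 := by
        rw [h0, zero_pow two_ne_zero, dotp,
          Finset.sum_eq_zero_iff_of_nonneg fun _ _ => mul_self_nonneg _] at hrr
        simpa using hrr l (Finset.mem_univ _)
      rw [h0]; linarith
    · have : s * q l = r l := by simp [hq, h0]
      linarith
  have hsq : s * dotp q q = s := by
    rw [hqq]
    by_cases h0 : s = 0
    · simp [h0]
    · field_simp
  have hqq1 : dotp q q ≤ 1 := by
    rw [hqq]
    by_cases h0 : s = 0
    · simp [h0]
    · rw [inv_pow, inv_mul_cancel₀ (pow_ne_zero 2 h0)]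
  obtain ⟨B, hB, hgood⟩ := exists_card_le_forall_abs_dotp_lt (k := k) (by omega) ![x, y] ![x, q]
    hρ hτ0 (by intro a l; fin_cases a; exacts [hxl l, hyl l])
    (by intro b; fin_cases b; exacts [hxx.le, hqq1])
  refine le_radPi_of_card_le _ B (hB.trans (le_of_eq ?_)) fun ω hω => ?_
  · have h1 : τ ^ 2 / (4 * ρ ^ 2) = M := by rw [hτ2]; field_simp
    rw [h1, Real.exp_neg, hM, Real.exp_log (by linarith), Nat.cast_sub (by omega)]
    have : (k : ℝ) - 1 ≠ 0 := by linarith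
    push_cast
    field_simp
  · have hg := hgood ω hω
    refine gkOrth_of_abs_dotp_le hkd _
      (fun i : Fin k => shift (i : ℕ) (fun l => signVec ω l * q l)) _ c s
      (fun i => ?_) (fun i => ?_) (fun i => ?_) (fun i => ?_) τ _ hγ.le ?_
      (fun i j hij => hg 0 0 i i.2 j j.2 (Fin.val_ne_of_ne hij))
      (fun i j hij => hg 0 1 i i.2 j j.2 (Fin.val_ne_of_ne hij))
      (fun i j hij => hg 1 0 i i.2 j j.2 (Fin.val_ne_of_ne hij))
      (fun i j hij => hg 1 1 i i.2 j j.2 (Fin.val_ne_of_ne hij))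
    · ext l
      simp only [shift, Pi.add_apply, Pi.smul_apply, smul_eq_mul, hyq]
      ring
    · rw [dotp_shift_self, hxx]
    · rw [dotp_shift_self, hxq]
    · rw [dotp_shift_self, hsq]
    · rw [mul_pow 4, Real.sq_sqrt hρ.le, hτ2]
      have : ρ * (((k : ℝ) - 1) * M) < 2 := by
        have := mul_le_mul_of_nonneg_left hlog hρ.le
        linarith
      calc 2 * ((k : ℝ) - 1) * (4 * ρ ^ 2 * M) = 8 * ρ * (ρ * ((k - 1) * M)) := by ring
        _ < 8 * ρ * 2 := mul_lt_mul_of_pos_left this (by positivity)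
        _ = 4 ^ 2 * ρ := by ring

end
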